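/- arXiv:1201.1266 — 3 statements merged into one kernel-verified Lean document; each statement's English description precedes it below -/
import Mathlib

section
/- Let c₅ = 40, A₀, B₀ > 0, set T = 10·A₀²/c₅, and suppose A, B : [0,T) → ℝ are differentiable with A(0) = A₀, B(0) = B₀, A(t) > 0 and B(t) > 0 for all t, A'(t) = −c₅/(20·A(t)), and B'(t) = −c₅·B(t)/(4·A(t)²) for all t ∈ [0,T). Then B(t)/A(t) = (B₀/A₀⁵)·A(t)⁴ for all t ∈ [0,T), and lim_{t → T⁻} B(t)/A(t) = 0. (Geometrically: the curvature scale c₅/A(t) times the squared injectivity-radius bound π²·B(t) tends to 0, so the finite time singularity is collapsed on the scale of curvature.) -/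
open Set Filter

/-- A function whose derivative vanishes on `[0, T)` is constantly equal to its initial value. -/
lemma eq_initial_of_hasDerivWithinAt_zero {f : ℝ → ℝ} {T : ℝ}
    (hf : ∀ t ∈ Ico (0 : ℝ) T, HasDerivWithinAt f 0 (Ico (0 : ℝ) T) t) :
    ∀ t ∈ Ico (0 : ℝ) T, f t = f 0 := by
  intro t ht
  have h := (convex_Ico (0 : ℝ) T).norm_image_sub_le_of_norm_hasDerivWithin_le (C := 0)
    hf (by simp) ⟨le_rfl, ht.1.trans_lt ht.2⟩ ht
  rw [zero_mul, norm_le_zero_iff] at h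
  exact sub_eq_zero.mp h

/-- On `M⁶ = S⁵ × S¹` with metric `A(t)·g_{S⁵} ⊕ B(t)·g_{S¹}`, the `L²` flow reduces to the
ODE system `A' = -c₅/(20 A)`, `B' = -c₅ B/(4 A²)` with `c₅ = 40`, and the solution exists up to
the singular time `T = 10 A₀²/c₅`.  For any positive solution on `[0, T)` one has
`B(t)/A(t) = (B₀/A₀⁵)·A(t)⁴`, and `B(t)/A(t) → 0` as `t → T⁻`: the finite time singularity is
collapsed on the scale of curvature. -/
theorem l2_flow_S5_x_S1_collapsed_singularity
    (c₅ : ℝ) (hc : c₅ = 40) (A₀ B₀ : ℝ) (hA₀ : 0 < A₀) (hB₀ : 0 < B₀)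
    (T : ℝ) (hT : T = 10 * A₀ ^ 2 / c₅)
    (A B : ℝ → ℝ)
    (hA0 : A 0 = A₀) (hB0 : B 0 = B₀)
    (hApos : ∀ t ∈ Ico (0 : ℝ) T, 0 < A t)
    (hBpos : ∀ t ∈ Ico (0 : ℝ) T, 0 < B t)
    (hA' : ∀ t ∈ Ico (0 : ℝ) T,
      HasDerivWithinAt A (-c₅ / (20 * A t)) (Ico (0 : ℝ) T) t)
    (hB' : ∀ t ∈ Ico (0 : ℝ) T,
      HasDerivWithinAt B (-c₅ * B t / (4 * (A t) ^ 2)) (Ico (0 : ℝ) T) t) :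
    (∀ t ∈ Ico (0 : ℝ) T, B t / A t = (B₀ / A₀ ^ 5) * (A t) ^ 4) ∧
    Tendsto (fun t => B t / A t) (nhdsWithin T (Iio T)) (nhds 0) := by
  subst hc
  have hT4 : T = A₀ ^ 2 / 4 := by rw [hT]; ring
  have hTpos : 0 < T := by rw [hT4]; positivity
  have hA_sq : ∀ t ∈ Ico (0 : ℝ) T, A t ^ 2 = A₀ ^ 2 - 4 * t := by
    intro t ht
    have h := eq_initial_of_hasDerivWithinAt_zero (f := fun s => A s ^ 2 + 4 * s) (T := T)
      (fun s hs => by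
        have hne := (hApos s hs).ne'
        refine (((hA' s hs).fun_pow 2).fun_add
          ((hasDerivWithinAt_id s _).const_mul 4)).congr_deriv ?_
        field_simp
        push_cast
        ring) t ht
    simp only [hA0, mul_zero, add_zero] at h
    linarith
  have hratio : ∀ t ∈ Ico (0 : ℝ) T, B t / A t = (B₀ / A₀ ^ 5) * (A t) ^ 4 := by
    intro t ht
    have h := eq_initial_of_hasDerivWithinAt_zero (f := fun s => B s / A s ^ 5) (T := T)
      (fun s hs => by
        have hne := (hApos s hs).ne'
        refine ((hB' s hs).fun_div ((hA' s hs).fun_pow 5) (pow_ne_zero 5 hne)).congr_deriv ?_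
        field_simp
        push_cast
        ring) t ht
    simp only [hA0, hB0] at h
    have hne := (hApos t ht).ne'
    rw [← h]
    field_simp
  refine ⟨hratio, ?_⟩
  have hlim : Tendsto (fun t : ℝ => (B₀ / A₀ ^ 5) * (A₀ ^ 2 - 4 * t) ^ 2)
      (nhdsWithin T (Iio T)) (nhds 0) := by
    have hcont : Continuous fun t : ℝ => (B₀ / A₀ ^ 5) * (A₀ ^ 2 - 4 * t) ^ 2 := by fun_prop
    have hzero : (B₀ / A₀ ^ 5) * (A₀ ^ 2 - 4 * T) ^ 2 = 0 := by rw [hT4]; ring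
    exact hzero ▸ (hcont.tendsto T).mono_left nhdsWithin_le_nhds
  refine hlim.congr' ?_
  filter_upwards [Ico_mem_nhdsLT hTpos] with t ht
  rw [hratio t ht, ← hA_sq t ht]
  ring
end

section
/- There exists a universal constant δ > 0 with the following property: for all real numbers a < b and every twice continuously differentiable function ψ : [a,b] → ℝ satisfying ψ(a) = ψ(b) = 0, ψ'(a) = 1, ψ'(b) = −1, ψ(s) > 0 for all s ∈ (a,b), together with the bounds |ψ''(s)| ≤ ψ(s) and |1 − ψ'(s)²| ≤ ψ(s)² for all s ∈ (a,b), one has b − a ≥ δ. -/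
open Set

/-- There is a universal `δ > 0` such that every `SO(3)`-invariant metric on `S³` with
`|Rm| ≤ 1` has pole-to-pole distance `L = b - a ≥ δ`.  The metric is encoded by a `C²` warping
function `ψ : [a,b] → ℝ` (with first derivative `ψ'` and second derivative `ψ''`) with
`ψ(a) = ψ(b) = 0`, `ψ'(a) = 1`, `ψ'(b) = -1`, `ψ > 0` on `(a,b)`, and the curvature bound
`|Rm| ≤ 1` is encoded by `|ψ''| ≤ ψ` and `|1 - (ψ')²| ≤ ψ²` on `(a,b)`. -/
theorem so3_invariant_bounded_curvature_length_lower_bound :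
    ∃ δ : ℝ, 0 < δ ∧
      ∀ (a b : ℝ), a < b →
        ∀ ψ ψ' ψ'' : ℝ → ℝ,
          (∀ s ∈ Icc a b, HasDerivWithinAt ψ (ψ' s) (Icc a b) s) →
          (∀ s ∈ Icc a b, HasDerivWithinAt ψ' (ψ'' s) (Icc a b) s) →
          ContinuousOn ψ'' (Icc a b) →
          ψ a = 0 → ψ b = 0 → ψ' a = 1 → ψ' b = -1 →
          (∀ s ∈ Ioo a b, 0 < ψ s) →
          (∀ s ∈ Ioo a b, |ψ'' s| ≤ ψ s) →
          (∀ s ∈ Ioo a b, |1 - (ψ' s) ^ 2| ≤ (ψ s) ^ 2) →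
          δ ≤ b - a := by
  refine ⟨1, one_pos, ?_⟩
  intro a b hab ψ ψ' ψ'' hψ hψ' _ ha hb _ _ hpos hcurv _
  have hderiv {f f' : ℝ → ℝ} (h : ∀ s ∈ Icc a b, HasDerivWithinAt f (f' s) (Icc a b) s)
      (s : ℝ) (hs : s ∈ Ioo a b) : HasDerivAt f (f' s) s :=
    (h s (Ioo_subset_Icc_self hs)).hasDerivAt (Icc_mem_nhds hs.1 hs.2)
  have hcψ : ContinuousOn ψ (Icc a b) := fun s hs => (hψ s hs).continuousWithinAt
  have hcψ' : ContinuousOn ψ' (Icc a b) := fun s hs => (hψ' s hs).continuousWithinAt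
  -- At an interior maximum `c` of `ψ` the derivative vanishes.
  obtain ⟨c, hc, hmax⟩ := isCompact_Icc.exists_isMaxOn (nonempty_Icc.2 hab.le) hcψ
  have hM : 0 < ψ c := by
    have hmid : (a + b) / 2 ∈ Ioo a b := ⟨by linarith, by linarith⟩
    exact (hpos _ hmid).trans_le (hmax (Ioo_subset_Icc_self hmid))
  have hac : a < c := lt_of_le_of_ne hc.1 (by rintro rfl; linarith)
  have hcb : c < b := lt_of_le_of_ne hc.2 (by rintro rfl; linarith)
  have hc0 : ψ' c = 0 :=
    (hmax.isLocalMax (Icc_mem_nhds hac hcb)).hasDerivAt_eq_zero (hderiv hψ c ⟨hac, hcb⟩)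
  -- Two applications of the mean value theorem give `ψ c ≤ ψ c * (b - a) ^ 2`.
  obtain ⟨d, hd, hd'⟩ := exists_hasDerivAt_eq_slope ψ ψ' hac
    (hcψ.mono (Icc_subset_Icc_right hcb.le))
    (fun s hs => hderiv hψ s ⟨hs.1, hs.2.trans hcb⟩)
  obtain ⟨e, he, he'⟩ := exists_hasDerivAt_eq_slope ψ' ψ'' hd.2
    (hcψ'.mono (Icc_subset_Icc hd.1.le hcb.le))
    (fun s hs => hderiv hψ' s ⟨hd.1.trans hs.1, hs.2.trans hcb⟩)
  have heI : e ∈ Ioo a b := ⟨hd.1.trans he.1, he.2.trans hcb⟩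
  have hbound : -ψ'' e ≤ ψ c :=
    (neg_le_abs _).trans ((hcurv e heI).trans (hmax (Ioo_subset_Icc_self heI)))
  have hca : 0 < c - a := sub_pos.2 hac
  have hcd : 0 < c - d := sub_pos.2 hd.2
  rw [ha, sub_zero, eq_div_iff hca.ne'] at hd'
  rw [hc0, zero_sub, eq_div_iff hcd.ne'] at he'
  have hle : ψ c * 1 ≤ ψ c * ((c - d) * (c - a)) :=
    calc ψ c * 1 = -ψ'' e * ((c - d) * (c - a)) := by
          linear_combination (c - a) * he' - hd'
      _ ≤ ψ c * ((c - d) * (c - a)) := by gcongr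
  have hone : 1 ≤ (c - d) * (c - a) := le_of_mul_le_mul_left hle hM
  nlinarith [hd.1]
end

section
/- Let L > 0, let κ ∈ ℝ with |κ| = 1, and let ψ : ℝ → ℝ be a continuously differentiable function which is periodic with period L and satisfies ψ(s) > 0 for all s ∈ ℝ. If |κ − ψ'(s)²| ≤ ψ(s)² for all s ∈ ℝ, then ψ(s) ≥ 1 for all s ∈ ℝ. -/
/-- For a warped product metric `ds² + ψ(s)²·g_Σ` on `S¹ × Σ` with `K_Σ = κ`, `|κ| = 1`
(`χ(Σ) ≠ 0`), encoded by a positive `C¹` function `ψ : ℝ → ℝ` of period `L > 0`, the curvature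
bound `|Rm| ≤ 1` gives `|κ - (ψ')²| ≤ ψ²` everywhere, and this forces `ψ ≥ 1` everywhere: the
fibers have definite size. -/
theorem warped_product_bounded_curvature_fiber_lower_bound
    (L : ℝ) (hL : 0 < L) (κ : ℝ) (hκ : |κ| = 1)
    (ψ : ℝ → ℝ) (hψ : ContDiff ℝ 1 ψ) (hper : Function.Periodic ψ L)
    (hpos : ∀ s : ℝ, 0 < ψ s)
    (hbound : ∀ s : ℝ, |κ - (deriv ψ s) ^ 2| ≤ (ψ s) ^ 2) :
    ∀ s : ℝ, 1 ≤ ψ s := by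
  have hcompact : IsCompact (Set.range ψ) :=
    hper.compact_of_continuous hL.ne' hψ.continuous
  obtain ⟨_, ⟨s₀, rfl⟩, hmin⟩ := hcompact.exists_isLeast (Set.range_nonempty ψ)
  have hle : ∀ s, ψ s₀ ≤ ψ s := fun s => hmin (Set.mem_range_self s)
  have hderiv : deriv ψ s₀ = 0 :=
    IsLocalMin.deriv_eq_zero (Filter.Eventually.of_forall hle)
  have hsq : 1 ≤ ψ s₀ ^ 2 := by simpa [hderiv, hκ] using hbound s₀
  exact fun s => ((one_le_sq_iff₀ (hpos s₀).le).mp hsq).trans (hle s)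
end
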